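/- Fix valences ς = (s_1, …, s_d) of positive integers with s_1 + ⋯ + s_d = 2N, let α be a ς-valenced link pattern, and let p_1 < ⋯ < p_d be real numbers. Define F(x_1, …, x_{2N}) = Σ_{β ∈ LP_N, β ≥_ς α} det( 1/(π (x_{a_k} − x_{b_ℓ})²) )_{k,ℓ=1}^{N} for x_1 < ⋯ < x_{2N}. Then the following iterated limits, taken one variable at a time (first the group-1 limits, innermost first: lim_{x_1 → p_1}, then lim_{x_2 → p_1} |x_2 − p_1|^{−1}·( · ), …, then lim_{x_{q_1} → p_1} |x_{q_1} − p_1|^{−(s_1−1)}·( · ); then analogously the group-2 limits towards p_2 with renormalizations |x_{q_1+r} − p_2|^{−(r−1)} for r = 1, …, s_2; and so on up to the group-d limits towards p_d), all exist, and U_α(p_1, …, p_d) = ( ∏_{j=1}^{d} 0! · 1! ⋯ (s_j − 1)! ) times the resulting iterated limit of F. -/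

import Mathlib

open scoped BigOperators Classical

namespace UST

/-- Partial sums of the valences: `q j = s_1 + ⋯ + s_j`. -/
def q (s : ℕ → ℕ) (j : ℕ) : ℕ := ∑ i ∈ Finset.range j, s i

/-- The group (0-based) of the 0-based position `t ∈ {0, …, 2N−1}`:
the unique `j` with `q j ≤ t < q (j+1)`. -/
def grp (d : ℕ) (s : ℕ → ℕ) (t : ℕ) : ℕ :=
  ((Finset.range d).filter (fun j => q s (j + 1) ≤ t)).card

/-- The 0-based offset of position `t` within its group. -/
def off (d : ℕ) (s : ℕ → ℕ) (t : ℕ) : ℕ := t - q s (grp d s t)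

/-- A (labeled) `N`-link pattern in left-to-right orientation: `β.1 k` and `β.2 k` are the
0-based left and right endpoints of the `k`-th link; the left endpoints increase, each link
satisfies `a_k < b_k`, the links partition `{0, …, 2N−1}`, and the pattern is noncrossing. -/
def isLP (N : ℕ) (β : (Fin N → Fin (2 * N)) × (Fin N → Fin (2 * N))) : Prop :=
  (∀ k l : Fin N, k < l → β.1 k < β.1 l) ∧
    (∀ k, β.1 k < β.2 k) ∧
    Function.Bijective (Sum.elim β.1 β.2) ∧
    ∀ k l, ¬(β.1 k < β.1 l ∧ β.1 l < β.2 k ∧ β.2 k < β.2 l)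

/-- The set of `N`-link patterns. -/
noncomputable def LP (N : ℕ) : Finset ((Fin N → Fin (2 * N)) × (Fin N → Fin (2 * N))) :=
  Finset.univ.filter (isLP N)

/-- The Dyck path of a link pattern: `path β t = #{k : a_k < t} − #{k : b_k < t}`. -/
def path (N : ℕ) (β : (Fin N → Fin (2 * N)) × (Fin N → Fin (2 * N))) (t : ℕ) : ℤ :=
  ((Finset.univ.filter (fun k : Fin N => ((β.1 k : ℕ)) < t)).card : ℤ) -
    ((Finset.univ.filter (fun k : Fin N => ((β.2 k : ℕ)) < t)).card : ℤ)

/-- The relation `β ≥_ς α`: the Dyck path of `β` dominates that of `α` and they agree at the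
group boundaries `q j`. -/
def geqVal (N d : ℕ) (s : ℕ → ℕ)
    (β α : (Fin N → Fin (2 * N)) × (Fin N → Fin (2 * N))) : Prop :=
  (∀ t, t ≤ 2 * N → path N α t ≤ path N β t) ∧
    ∀ j, j ≤ d → path N β (q s j) = path N α (q s j)

/-- `ς`-valenced link patterns: link patterns with no link inside a single group. -/
def valenced (N d : ℕ) (s : ℕ → ℕ)
    (α : (Fin N → Fin (2 * N)) × (Fin N → Fin (2 * N))) : Prop :=
  isLP N α ∧ ∀ k, grp d s (α.1 k : ℕ) ≠ grp d s (α.2 k : ℕ)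

/-- The fused symmetric kernel `𝔎` at the point `x = (x_1, …, x_d)` (0-based coordinates):
`𝔎(u,v) = 0` if `u, v` lie in the same group, and otherwise, with `u` in the earlier group
`i` at 1-based offset `m_u` and `v` in the later group `j` at 1-based offset `m_v`,
`𝔎(u,v) = (−1)^{m_v − 1} (m_u + m_v − 1)! / (π (x_j − x_i)^{m_u + m_v})`, i.e. the mixed
partial derivative `∂_{x_i}^{m_u−1} ∂_{x_j}^{m_v−1}` of `1/(π (x_i − x_j)²)`. -/
noncomputable def ker (d : ℕ) (s : ℕ → ℕ) (x : ℕ → ℝ) (u v : ℕ) : ℝ :=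
  if grp d s u = grp d s v then 0
  else
    let w : ℕ × ℕ := if grp d s u < grp d s v then (u, v) else (v, u)
    ((-1 : ℝ) ^ off d s w.2 * ((off d s w.1 + off d s w.2 + 1).factorial : ℝ)) /
      (Real.pi * (x (grp d s w.2) - x (grp d s w.1)) ^ (off d s w.1 + off d s w.2 + 2))

/-- The Fomin-type determinant `Δ_β` with the fused kernel. -/
noncomputable def Δ (N d : ℕ) (s : ℕ → ℕ) (x : ℕ → ℝ)
    (β : (Fin N → Fin (2 * N)) × (Fin N → Fin (2 * N))) : ℝ :=
  Matrix.det (Matrix.of fun k ℓ : Fin N => ker d s x (β.1 k : ℕ) (β.2 ℓ : ℕ))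

/-- The explicit basis function `U_α(x) = Σ_{β ≥_ς α} Δ_β(x)` of Theorem D.2 of the paper. -/
noncomputable def U (N d : ℕ) (s : ℕ → ℕ)
    (α : (Fin N → Fin (2 * N)) × (Fin N → Fin (2 * N))) (x : ℕ → ℝ) : ℝ :=
  ∑ β ∈ (LP N).filter (fun β => geqVal N d s β α), Δ N d s x β

/-- The chamber `𝔛_d` of ordered configurations (using the first `d` coordinates). -/
def chamber (d : ℕ) (x : ℕ → ℝ) : Prop := ∀ i j : ℕ, i < j → j < d → x i < x j

end UST

namespace UST

variable {N d : ℕ} {s : ℕ → ℕ}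

section LinkPatterns

variable {α β γ : (Fin N → Fin (2 * N)) × (Fin N → Fin (2 * N))}

/-- The bijection from openers and closers to positions given by a link pattern. -/
noncomputable def endpointEquiv (β : (Fin N → Fin (2 * N)) × (Fin N → Fin (2 * N)))
    (h : isLP N β) : Fin N ⊕ Fin N ≃ Fin (2 * N) :=
  Equiv.ofBijective _ h.2.2.1

@[simp]
theorem endpointEquiv_inl (h : isLP N β) (k : Fin N) : endpointEquiv β h (Sum.inl k) = β.1 k := rfl

@[simp]
theorem endpointEquiv_inr (h : isLP N β) (k : Fin N) : endpointEquiv β h (Sum.inr k) = β.2 k := rfl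

theorem isLP.fst_ne_snd (h : isLP N β) (k l : Fin N) : β.1 k ≠ β.2 l := fun e =>
  Sum.inl_ne_inr (h.2.2.1.1 (a₁ := Sum.inl k) (a₂ := Sum.inr l) e)

theorem isLP.snd_injective (h : isLP N β) : Function.Injective β.2 := fun k l e =>
  Sum.inr_injective (h.2.2.1.1 (a₁ := Sum.inr k) (a₂ := Sum.inr l) e)

theorem isLP.strictMono (h : isLP N β) : StrictMono β.1 := fun k l => h.1 k l

theorem isLP.mem_range_snd_iff (h : isLP N β) (i : Fin (2 * N)) :
    i ∈ Set.range β.2 ↔ i ∉ Set.range β.1 := by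
  constructor
  · rintro ⟨l, rfl⟩ ⟨k, hk⟩
    exact h.fst_ne_snd k l hk
  · intro hi
    obtain ⟨k | l, hk⟩ := h.2.2.1.2 i
    · exact (hi ⟨k, hk⟩).elim
    · exact ⟨l, hk⟩

theorem snd_eq_of_lt_imp {a b c : Fin N → Fin (2 * N)} (hb : isLP N (a, b)) (hc : isLP N (a, c))
    {k : Fin N} (ih : ∀ m, k < m → b m = c m) : ¬ b k < c k := by
  intro hlt
  obtain ⟨m, hm⟩ : b k ∈ Set.range c :=
    (hc.mem_range_snd_iff _).2 ((hb.mem_range_snd_iff _).1 ⟨k, rfl⟩)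
  rcases lt_trichotomy k m with hkm | rfl | hkm
  · exact hkm.ne (hb.snd_injective (hm.symm.trans (ih m hkm).symm))
  · exact hlt.ne hm.symm
  · refine hc.2.2.2 m k ⟨hc.1 m k hkm, ?_, ?_⟩
    · simpa [hm] using hb.2.1 k
    · simpa [hm] using hlt

/-- A link pattern is determined by its set of openers. -/
theorem isLP.eq_of_range_fst_eq (hβ : isLP N β) (hγ : isLP N γ)
    (h : Set.range β.1 = Set.range γ.1) : β = γ := by
  obtain ⟨a, b⟩ := β
  obtain ⟨a', c⟩ := γ
  obtain rfl : a = a' := (hβ.strictMono.range_inj hγ.strictMono).1 h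
  refine Prod.ext rfl (funext fun k => ?_)
  change b k = c k
  induction k using WellFoundedGT.induction with
  | ind k ih =>
    exact le_antisymm (not_lt.1 (snd_eq_of_lt_imp hγ hβ fun m hm => (ih m hm).symm))
      (not_lt.1 (snd_eq_of_lt_imp hβ hγ ih))

/-- The number of elements of `S` below `t`. -/
noncomputable def countBelow {n : ℕ} (S : Finset (Fin n)) (t : ℕ) : ℕ :=
  (S.filter fun i : Fin n => (i : ℕ) < t).card

theorem countBelow_succ {n : ℕ} (S : Finset (Fin n)) (i : Fin n) :
    countBelow S (i + 1) = countBelow S i + if i ∈ S then 1 else 0 := by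
  unfold countBelow
  split_ifs with h
  · rw [← Finset.card_insert_of_notMem (a := i) (by simp)]
    congr 1
    ext j
    simp only [Finset.mem_filter, Finset.mem_insert, Fin.ext_iff]
    grind
  · congr 1
    ext j
    simp only [Finset.mem_filter]
    grind

theorem countBelow_self {n : ℕ} (S : Finset (Fin n)) : countBelow S n = S.card := by
  simp [countBelow]

theorem countBelow_mono {n : ℕ} (S : Finset (Fin n)) : Monotone (countBelow S) := fun a b h =>
  Finset.card_le_card fun i => by simp only [Finset.mem_filter]; grind

/-- Every ballot sequence is the sequence of openers of a link pattern. -/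
theorem exists_isLP_of_ballot (S : Finset (Fin (2 * N))) (hS : S.card = N)
    (hb : ∀ t, t ≤ 2 * N → t ≤ 2 * countBelow S t) :
    ∃ β, isLP N β ∧ Set.range β.1 = S := by
  set H : ℕ → ℤ := fun t => 2 * (countBelow S t : ℤ) - t with hH
  have H_nonneg : ∀ t, t ≤ 2 * N → 0 ≤ H t := fun t ht => by
    have := hb t ht
    simp only [hH]; omega
  have H_last : H (2 * N) = 0 := by simp [hH, countBelow_self, hS]
  have H_succ : ∀ i : Fin (2 * N), H (i + 1) = H i + if i ∈ S then 1 else -1 := fun i => by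
    simp only [hH, countBelow_succ]
    split_ifs <;> push_cast <;> ring
  set a : Fin N → Fin (2 * N) := fun k => S.orderEmbOfFin hS k
  have haS : ∀ k, a k ∈ S := fun k => Finset.orderEmbOfFin_mem S hS k
  have ha_mono : StrictMono a := (S.orderEmbOfFin hS).strictMono
  have hret : ∀ k, ∃ b : Fin (2 * N), (a k < b ∧ H (b + 1) ≤ H (a k)) ∧
      ∀ c, c < b → ¬ (a k < c ∧ H (c + 1) ≤ H (a k)) := by
    intro k
    have hpos : 0 < 2 * N := (Nat.zero_le _).trans_lt (a k).2
    have hex : ∃ b : Fin (2 * N), a k < b ∧ H (b + 1) ≤ H (a k) := by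
      refine ⟨⟨2 * N - 1, by omega⟩, ?_, ?_⟩
      · have h1 := H_succ (a k)
        rw [if_pos (haS k)] at h1
        have h2 := H_nonneg (a k) (a k).2.le
        have h3 : (a k : ℕ) ≠ 2 * N - 1 := fun e => by
          rw [e, Nat.sub_add_cancel hpos, H_last, ← e] at h1
          omega
        rw [Fin.lt_def]
        have := (a k).2
        simp only
        omega
      · simp only [Nat.sub_add_cancel hpos, H_last]
        exact H_nonneg _ (a k).2.le
    obtain ⟨b, hb, hmin⟩ := WellFounded.has_min (wellFounded_lt (α := Fin (2 * N)))
      {b | a k < b ∧ H (b + 1) ≤ H (a k)} hex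
    exact ⟨b, hb, fun c hc h => hmin c h hc⟩
  choose b hb' hmin using hret
  have hab : ∀ k, a k < b k := fun k => (hb' k).1
  have above : ∀ k (t : ℕ), (a k : ℕ) < t → t ≤ b k → H (a k) < H t := by
    intro k t h1 h2
    obtain ⟨c, rfl⟩ : ∃ c, t = c + 1 := ⟨t - 1, by omega⟩
    have hc : c < 2 * N := by have := (b k).2; omega
    rcases eq_or_ne c (a k) with rfl | hne
    · rw [H_succ, if_pos (haS k)]; omega
    · have := hmin k ⟨c, hc⟩ (by rw [Fin.lt_def]; simp only; omega)
      rw [not_and, Fin.lt_def] at this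
      exact not_le.1 (this (by simp only; omega))
  have hbS : ∀ k, b k ∉ S := fun k hk => by
    have h1 := H_succ (b k)
    rw [if_pos hk] at h1
    have := above k (b k) (hab k) le_rfl
    have := (hb' k).2
    omega
  have hret : ∀ k, H (b k + 1) = H (a k) := fun k => by
    have h1 := H_succ (b k)
    rw [if_neg (hbS k)] at h1
    have := above k (b k) (hab k) le_rfl
    have := (hb' k).2
    omega
  have hlt : ∀ k l, a k < a l → a l < b k → b k ≠ b l := fun k l h1 h2 e => by
    have h3 := above k (a l) h1 h2.le
    rw [← hret k, ← hret l, e] at h3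
    exact lt_irrefl _ h3
  have hb_inj : Function.Injective b := by
    intro k l e
    rcases lt_trichotomy k l with h | h | h
    · exact (hlt k l (ha_mono h) (e ▸ hab l) e).elim
    · exact h
    · exact (hlt l k (ha_mono h) (e ▸ hab k) e.symm).elim
  refine ⟨(a, b), ⟨fun k l h => ha_mono h, hab, ?_, ?_⟩, ?_⟩
  · rw [Fintype.bijective_iff_injective_and_card]
    refine ⟨Function.Injective.sumElim ha_mono.injective hb_inj fun k l e => ?_, by simp; ring⟩
    exact hbS l ((show a k = b l from e) ▸ haS k)
  · rintro k l ⟨h1, h2, h3⟩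
    have h4 := above k (a l) h1 h2.le
    have h5 := above l (b k + 1) (Nat.lt_succ_of_lt h2) h3
    rw [hret k] at h5
    exact lt_asymm h4 h5
  · exact Finset.range_orderEmbOfFin S hS

/-- The listing `0, 2, 4, …` of openers and `1, 3, 5, …` of closers. -/
noncomputable def interleave (N : ℕ) : Fin N ⊕ Fin N ≃ Fin (2 * N) :=
  Equiv.ofBijective
    (Sum.elim (fun k => ⟨2 * k, by omega⟩) fun k => ⟨2 * k + 1, by omega⟩) <| by
    rw [Fintype.bijective_iff_injective_and_card]
    refine ⟨Function.Injective.sumElim ?_ ?_ ?_, by simp; ring⟩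
    · intro k l h
      simp only [Fin.mk.injEq] at h
      omega
    · intro k l h
      simp only [Fin.mk.injEq] at h
      omega
    · intro k l h
      simp only [Fin.mk.injEq] at h
      omega

theorem interleave_inl (k : Fin N) : (interleave N (Sum.inl k) : ℕ) = 2 * k := rfl

theorem interleave_inr (k : Fin N) : (interleave N (Sum.inr k) : ℕ) = 2 * k + 1 := rfl

/-- For a noncrossing pattern the word `a₁ b₁ a₂ b₂ ⋯` is an even permutation. -/
theorem sign_interleave_symm_trans (h : isLP N β) :
    Equiv.Perm.sign ((interleave N).symm.trans (endpointEquiv β h)) = 1 := by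
  rw [Equiv.Perm.sign_eq_prod_prod_Iio]
  set w := (interleave N).symm.trans (endpointEquiv β h)
  have hw1 : ∀ k, w (interleave N (Sum.inl k)) = β.1 k := fun k => by simp [w]
  have hw2 : ∀ k, w (interleave N (Sum.inr k)) = β.2 k := fun k => by simp [w]
  have hfilter : ∀ j : Fin (2 * N), ∏ i ∈ Finset.Iio j, (if w i < w j then 1 else -1 : ℤˣ) =
      ∏ i, if i < j then (if w i < w j then 1 else -1 : ℤˣ) else 1 := fun j => by
    rw [← Finset.prod_filter]
    congr 1
    ext; simp
  simp_rw [hfilter]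
  rw [← (interleave N).prod_comp, Fintype.prod_sum_type, ← Finset.prod_mul_distrib]
  refine Finset.prod_eq_one fun l _ => ?_
  rw [← (interleave N).prod_comp, ← (interleave N).prod_comp, Fintype.prod_sum_type,
    Fintype.prod_sum_type, ← Finset.prod_mul_distrib, ← Finset.prod_mul_distrib,
    ← Finset.prod_mul_distrib]
  refine Finset.prod_eq_one fun k _ => ?_
  simp only [hw1, hw2, Fin.lt_def (a := interleave N _), interleave_inl, interleave_inr]
  rcases lt_trichotomy k l with hkl | rfl | hkl
  · have hkl' := Fin.lt_def.1 hkl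
    rw [if_pos (show 2 * (k : ℕ) < 2 * l by omega),
      if_pos (show 2 * (k : ℕ) + 1 < 2 * l by omega),
      if_pos (show 2 * (k : ℕ) < 2 * l + 1 by omega),
      if_pos (show 2 * (k : ℕ) + 1 < 2 * l + 1 by omega)]
    have h1 := h.1 k l hkl
    have h2 := h.2.1 l
    have h3 := h.2.2.2 k l
    have h4 : β.2 k ≠ β.2 l := fun e => hkl.ne (h.snd_injective e)
    have h5 := h.fst_ne_snd l k
    rw [if_pos h1, if_pos (h1.trans h2)]
    rcases lt_or_ge (β.2 k) (β.1 l) with h6 | h6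
    · rw [if_pos h6, if_pos (h6.trans h2)]; simp
    · rw [if_neg h6.not_gt,
        if_neg fun h7 => h3 ⟨h1, lt_of_le_of_ne h6 h5, h7⟩]
      simp
  · simp [h.2.1 k]
  · have hkl' := Fin.lt_def.1 hkl
    rw [if_neg (show ¬ 2 * (k : ℕ) < 2 * l by omega),
      if_neg (show ¬ 2 * (k : ℕ) + 1 < 2 * l by omega),
      if_neg (show ¬ 2 * (k : ℕ) < 2 * l + 1 by omega),
      if_neg (show ¬ 2 * (k : ℕ) + 1 < 2 * l + 1 by omega)]
    simp

/-- If a transposition of positions carries the openers of `β` to those of `γ`, then it carries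
the determinant of `β` to minus that of `γ`. -/
theorem det_comp_swap_eq_neg (hβ : isLP N β) (hγ : isLP N γ) {u v : Fin (2 * N)} (huv : u ≠ v)
    (h : ∀ i, i ∈ Set.range β.1 ↔ Equiv.swap u v i ∈ Set.range γ.1)
    (K : Fin (2 * N) → Fin (2 * N) → ℝ) :
    Matrix.det (Matrix.of fun k l : Fin N =>
        K (Equiv.swap u v (β.1 k)) (Equiv.swap u v (β.2 l))) =
      -Matrix.det (Matrix.of fun k l : Fin N => K (γ.1 k) (γ.2 l)) := by
  have h1 : ∀ k, ∃ k', γ.1 k' = Equiv.swap u v (β.1 k) := fun k => (h _).1 ⟨k, rfl⟩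
  have h2 : ∀ k, ∃ k', γ.2 k' = Equiv.swap u v (β.2 k) := fun k => by
    refine (hγ.mem_range_snd_iff _).2 fun hk => ?_
    exact (hβ.mem_range_snd_iff _).1 ⟨k, rfl⟩ ((h _).2 hk)
  choose σ' hσ' using h1
  choose ρ' hρ' using h2
  have σ_bij : Function.Bijective σ' := Finite.injective_iff_bijective.1 fun k l e =>
    hβ.strictMono.injective ((Equiv.swap u v).injective (by rw [← hσ', ← hσ', e]))
  have ρ_bij : Function.Bijective ρ' := Finite.injective_iff_bijective.1 fun k l e =>
    hβ.snd_injective ((Equiv.swap u v).injective (by rw [← hρ', ← hρ', e]))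
  set σ : Equiv.Perm (Fin N) := Equiv.ofBijective σ' σ_bij
  set ρ : Equiv.Perm (Fin N) := Equiv.ofBijective ρ' ρ_bij
  have hσ : ∀ k, γ.1 (σ k) = Equiv.swap u v (β.1 k) := hσ'
  have hρ : ∀ k, γ.2 (ρ k) = Equiv.swap u v (β.2 k) := hρ'
  have key : Equiv.swap u v * (interleave N).symm.trans (endpointEquiv β hβ) =
      (interleave N).symm.trans (endpointEquiv γ hγ) *
        ((interleave N).symm.trans (Equiv.Perm.sumCongr σ ρ)).trans (interleave N) := by
    refine Equiv.ext fun i => ?_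
    obtain ⟨k | k, rfl⟩ := (interleave N).surjective i <;> simp [hσ, hρ]
  have hsign := congrArg Equiv.Perm.sign key
  rw [Equiv.Perm.sign_mul, Equiv.Perm.sign_mul, sign_interleave_symm_trans,
    sign_interleave_symm_trans, Equiv.Perm.sign_symm_trans_trans, Equiv.Perm.sign_sumCongr,
    Equiv.Perm.sign_swap huv, mul_one, one_mul] at hsign
  have hdet : (Matrix.of fun k l : Fin N =>
      K (Equiv.swap u v (β.1 k)) (Equiv.swap u v (β.2 l))) =
      ((Matrix.of fun k l : Fin N => K (γ.1 k) (γ.2 l)).submatrix σ id).submatrix id ρ := by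
    ext k l
    simp [hσ, hρ]
  rw [hdet, Matrix.det_permute', Matrix.det_permute, ← mul_assoc, mul_comm (_ : ℝ) (_ : ℝ),
    mul_comm (((Equiv.Perm.sign ρ : ℤˣ) : ℤ) : ℝ)]
  have : (((Equiv.Perm.sign σ : ℤˣ) : ℤ) : ℝ) * (((Equiv.Perm.sign ρ : ℤˣ) : ℤ) : ℝ) = -1 := by
    have := congrArg (fun z : ℤˣ => ((z : ℤ) : ℝ)) hsign
    simpa using this.symm
  rw [this]
  ring

theorem card_fst_lt_add_card_snd_lt (h : isLP N β) {t : ℕ} (ht : t ≤ 2 * N) :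
    (Finset.univ.filter fun k : Fin N => (β.1 k : ℕ) < t).card +
      (Finset.univ.filter fun k : Fin N => (β.2 k : ℕ) < t).card = t := by
  have h1 := h.2.2.1.sum_comp fun i : Fin (2 * N) => if (i : ℕ) < t then 1 else 0
  rw [Fintype.sum_sum_type] at h1
  simp only [Sum.elim_inl, Sum.elim_inr] at h1
  rw [← Finset.card_filter, Fin.card_filter_val_lt, min_eq_right ht] at h1
  rw [Finset.card_filter, Finset.card_filter]
  convert h1 using 3 <;> exact if_congr Iff.rfl rfl rfl

theorem path_eq (h : isLP N β) {t : ℕ} (ht : t ≤ 2 * N) :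
    path N β t = 2 * (countBelow (Finset.univ.image β.1) t : ℤ) - t := by
  have h1 := card_fst_lt_add_card_snd_lt h ht
  have h2 : countBelow (Finset.univ.image β.1) t =
      (Finset.univ.filter fun k : Fin N => (β.1 k : ℕ) < t).card := by
    rw [countBelow, Finset.filter_image, Finset.card_image_of_injective _ h.strictMono.injective]
  rw [path, h2]
  omega

end LinkPatterns

section Groups

theorem q_succ (s : ℕ → ℕ) (j : ℕ) : q s (j + 1) = q s j + s j := Finset.sum_range_succ _ _

theorem q_mono (s : ℕ → ℕ) : Monotone (q s) :=
  monotone_nat_of_le_succ fun j => by rw [q_succ]; exact Nat.le_add_right _ _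

theorem grp_mono (d : ℕ) (s : ℕ → ℕ) : Monotone (grp d s) := fun a b h =>
  Finset.card_le_card fun i => by simp only [Finset.mem_filter]; grind

theorem grp_eq {t j : ℕ} (hj : j < d) (h1 : q s j ≤ t) (h2 : t < q s (j + 1)) :
    grp d s t = j := by
  have : (Finset.range d).filter (fun i => q s (i + 1) ≤ t) = Finset.range j := by
    ext i
    simp only [Finset.mem_filter, Finset.mem_range]
    constructor
    · rintro ⟨-, h⟩
      by_contra! hij
      have := q_mono s (show j + 1 ≤ i + 1 by omega)
      omega
    · intro h
      exact ⟨h.trans hj, (q_mono s (show i + 1 ≤ j by omega)).trans h1⟩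
  rw [grp, this, Finset.card_range]

theorem grp_spec {t : ℕ} (ht : t < q s d) :
    grp d s t < d ∧ q s (grp d s t) ≤ t ∧ t < q s (grp d s t + 1) := by
  obtain ⟨j, hj, h1, h2⟩ : ∃ j, j < d ∧ q s j ≤ t ∧ t < q s (j + 1) := by
    induction d with
    | zero => simp [q] at ht
    | succ d ih =>
      rcases lt_or_ge t (q s d) with h | h
      · obtain ⟨j, hj, h1⟩ := ih h
        exact ⟨j, by omega, h1⟩
      · exact ⟨d, by omega, h, ht⟩
  rw [grp_eq hj h1 h2]
  exact ⟨hj, h1, h2⟩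

theorem lt_q_iff_grp_lt {t j : ℕ} (ht : t < q s d) : t < q s j ↔ grp d s t < j := by
  obtain ⟨-, h1, h2⟩ := grp_spec ht
  constructor
  · intro h
    by_contra! hj
    have := q_mono s hj
    omega
  · intro h
    exact h2.trans_le (q_mono s h)

theorem off_q_add {j r : ℕ} (hj : j < d) (hr : r < s j) : off d s (q s j + r) = r := by
  rw [off, grp_eq hj (Nat.le_add_right _ _) (by rw [q_succ]; omega), Nat.add_sub_cancel_left]

theorem prod_factorial_off :
    ∏ i ∈ Finset.range (q s d), ((off d s i).factorial : ℝ) =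
      ∏ j ∈ Finset.range d, ∏ r ∈ Finset.range (s j), (r.factorial : ℝ) := by
  suffices h : ∀ j, j ≤ d → ∏ i ∈ Finset.range (q s j), ((off d s i).factorial : ℝ) =
      ∏ j ∈ Finset.range j, ∏ r ∈ Finset.range (s j), (r.factorial : ℝ) from h d le_rfl
  intro j hj
  induction j with
  | zero => simp [q]
  | succ j ih =>
    rw [q_succ, Finset.prod_range_add, Finset.prod_range_succ, ih (by omega)]
    congr 1
    refine Finset.prod_congr rfl fun r hr => ?_
    rw [off_q_add (by omega) (Finset.mem_range.1 hr)]

theorem grp_swap {n : ℕ} {u v : Fin n} (huv : grp d s u = grp d s v) (i : Fin n) :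
    grp d s (Equiv.swap u v i) = grp d s i := by
  rcases eq_or_ne i u with rfl | h
  · simp [huv]
  · rcases eq_or_ne i v with rfl | h'
    · simp [huv]
    · rw [Equiv.swap_apply_of_ne_of_ne h h']

end Groups

section Domination

variable {α β : (Fin N → Fin (2 * N)) × (Fin N → Fin (2 * N))}

theorem countBelow_le_add {n : ℕ} (S : Finset (Fin n)) {a b : ℕ} (hab : a ≤ b) (hb : b ≤ n) :
    countBelow S b ≤ countBelow S a + (b - a) := by
  induction b, hab using Nat.le_induction with
  | base => simp
  | succ b hab ih =>
    have h1 := countBelow_succ S ⟨b, hb⟩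
    simp only at h1
    have := ih (by omega)
    split_ifs at h1 <;> omega

theorem countBelow_eq_add {n : ℕ} (S : Finset (Fin n)) {a b : ℕ} (hab : a ≤ b) (hb : b ≤ n)
    (h : ∀ i : Fin n, a ≤ i → (i : ℕ) < b → i ∈ S) :
    countBelow S b = countBelow S a + (b - a) := by
  induction b, hab using Nat.le_induction with
  | base => simp
  | succ b hab ih =>
    have h1 := countBelow_succ S ⟨b, hb⟩
    rw [if_pos (h ⟨b, hb⟩ hab (Nat.lt_succ_self b))] at h1
    simp only at h1
    have := ih (by omega) fun i hi hi' => h i hi (by omega)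
    omega

/-- In a valenced link pattern every group consists of closers followed by openers. -/
theorem valenced.snd_le_fst (hα : valenced N d s α) {k l : Fin N}
    (h : grp d s (α.1 k) = grp d s (α.2 l)) : α.2 l ≤ α.1 k := by
  by_contra! hlt
  have hk := hα.2 k
  have hl := hα.2 l
  refine hα.1.2.2.2 l k ⟨?_, hlt, ?_⟩
  · by_contra! hle
    exact hl (le_antisymm (grp_mono d s (hα.1.2.1 l).le) (h ▸ grp_mono d s hle))
  · by_contra! hle
    exact hk (le_antisymm (grp_mono d s (hα.1.2.1 k).le) (h ▸ grp_mono d s hle))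

theorem valenced.countBelow_le (hα : valenced N d s α) (hsum : q s d = 2 * N)
    (S : Finset (Fin (2 * N)))
    (hS : ∀ j, j ≤ d → countBelow S (q s j) = countBelow (Finset.univ.image α.1) (q s j))
    {t : ℕ} (ht : t ≤ 2 * N) :
    countBelow (Finset.univ.image α.1) t ≤ countBelow S t := by
  rcases ht.eq_or_lt with rfl | ht
  · have := hS d le_rfl
    rw [hsum] at this
    exact this.ge
  obtain ⟨hj, h1, h2⟩ := grp_spec (hsum ▸ ht)
  set j := grp d s t
  have hgrp : ∀ i, q s j ≤ i → i < q s (j + 1) → grp d s i = j := fun i => grp_eq hj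
  by_cases hcl : ∀ i : Fin (2 * N), q s j ≤ i → (i : ℕ) < t → i ∉ Finset.univ.image α.1
  · calc countBelow (Finset.univ.image α.1) t = countBelow (Finset.univ.image α.1) (q s j) := by
          unfold countBelow
          congr 1
          ext i
          simp only [Finset.mem_filter]
          have := hcl i
          grind
      _ = countBelow S (q s j) := (hS j hj.le).symm
      _ ≤ countBelow S t := countBelow_mono S h1
  · push Not at hcl
    obtain ⟨i, hi1, hi2, hi⟩ := hcl
    obtain ⟨k, -, rfl⟩ := Finset.mem_image.1 hi
    have hq : q s (j + 1) ≤ 2 * N := hsum ▸ q_mono s hj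
    have h3 := countBelow_eq_add (Finset.univ.image α.1) h2.le hq fun i hi hi' => by
      by_contra hni
      obtain ⟨l, rfl⟩ := (hα.1.mem_range_snd_iff i).2 (by simpa using hni)
      have := hα.snd_le_fst (k := k) (l := l)
        ((hgrp _ hi1 (by omega)).trans (hgrp _ (by omega) hi').symm)
      rw [Fin.le_def] at this
      omega
    have h4 := countBelow_le_add S h2.le hq
    have h5 := hS (j + 1) hj
    omega

theorem valenced.geqVal_iff (hα : valenced N d s α) (hsum : q s d = 2 * N) (hβ : isLP N β) :
    geqVal N d s β α ↔ ∀ j, j ≤ d → countBelow (Finset.univ.image β.1) (q s j) =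
      countBelow (Finset.univ.image α.1) (q s j) := by
  have hq : ∀ j, j ≤ d → q s j ≤ 2 * N := fun j hj => hsum ▸ q_mono s hj
  constructor
  · rintro ⟨-, h⟩ j hj
    have := h j hj
    rw [path_eq hβ (hq j hj), path_eq hα.1 (hq j hj)] at this
    omega
  · intro h
    refine ⟨fun t ht => ?_, fun j hj => ?_⟩
    · rw [path_eq hβ ht, path_eq hα.1 ht]
      have := hα.countBelow_le hsum _ h ht
      omega
    · rw [path_eq hβ (hq j hj), path_eq hα.1 (hq j hj), h j hj]

theorem path_nonneg (h : isLP N β) (t : ℕ) : 0 ≤ path N β t := by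
  have : (Finset.univ.filter fun k : Fin N => (β.2 k : ℕ) < t).card ≤
      (Finset.univ.filter fun k : Fin N => (β.1 k : ℕ) < t).card :=
    Finset.card_le_card fun k => by
      simp only [Finset.mem_filter, Finset.mem_univ, true_and]
      exact fun hk => lt_trans (h.2.1 k) hk
  rw [path]
  omega

/-- The set of link patterns above `α` is stable under transpositions within a group. -/
theorem valenced.exists_swap (hα : valenced N d s α) (hsum : q s d = 2 * N)
    {u v : Fin (2 * N)} (huv : grp d s u = grp d s v)
    (hβ : β ∈ (LP N).filter fun β => geqVal N d s β α) :
    ∃ γ ∈ (LP N).filter fun γ => geqVal N d s γ α,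
      ∀ i, i ∈ Set.range β.1 ↔ Equiv.swap u v i ∈ Set.range γ.1 := by
  simp only [LP, Finset.mem_filter, Finset.mem_univ, true_and] at hβ ⊢
  obtain ⟨hβ, hβα⟩ := hβ
  rw [hα.geqVal_iff hsum hβ] at hβα
  set S := (Finset.univ.image β.1).image (Equiv.swap u v) with hS_def
  have hswap : ∀ (i : Fin (2 * N)) (j : ℕ),
      ((Equiv.swap u v i : Fin (2 * N)) : ℕ) < q s j ↔ (i : ℕ) < q s j := fun i j => by
    rw [lt_q_iff_grp_lt (hsum.symm ▸ Fin.is_lt _ : _ < q s d),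
      lt_q_iff_grp_lt (hsum.symm ▸ Fin.is_lt _ : _ < q s d), grp_swap huv]
  have hS : ∀ j, j ≤ d → countBelow S (q s j) = countBelow (Finset.univ.image α.1) (q s j) := by
    intro j hj
    rw [← hβα j hj, countBelow, countBelow, hS_def, Finset.filter_image,
      Finset.card_image_of_injective _ (Equiv.injective _)]
    simp only [hswap]
  have hcard : S.card = N := by
    rw [hS_def, Finset.card_image_of_injective _ (Equiv.injective _),
      Finset.card_image_of_injective _ hβ.strictMono.injective]
    simp
  obtain ⟨γ, hγ, hγS⟩ := exists_isLP_of_ballot S hcard fun t ht => by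
    have h1 := hα.countBelow_le hsum S hS ht
    have h2 := path_nonneg hα.1 t
    rw [path_eq hα.1 ht] at h2
    omega
  refine ⟨γ, ⟨hγ, ?_⟩, fun i => ?_⟩
  · rw [hα.geqVal_iff hsum hγ]
    have : Finset.univ.image γ.1 = S := by
      rw [← Finset.coe_inj, ← hγS]
      simp
    rw [this]
    exact hS
  · rw [hγS, hS_def]
    simp

end Domination

section FominSum

variable {α : (Fin N → Fin (2 * N)) × (Fin N → Fin (2 * N))}

/-- The sum over `β ≥_ς α` of the determinants `det (K (a_k, b_ℓ))` for an arbitrary kernel. -/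
noncomputable def fominSum (N d : ℕ) (s : ℕ → ℕ)
    (α : (Fin N → Fin (2 * N)) × (Fin N → Fin (2 * N)))
    (K : Fin (2 * N) → Fin (2 * N) → ℝ) : ℝ :=
  ∑ β ∈ (LP N).filter (fun β => geqVal N d s β α),
    Matrix.det (Matrix.of fun k l : Fin N => K (β.1 k) (β.2 l))

theorem isLP_of_mem_filter {β : (Fin N → Fin (2 * N)) × (Fin N → Fin (2 * N))}
    (hβ : β ∈ (LP N).filter (fun β => geqVal N d s β α)) : isLP N β :=
  (Finset.mem_filter.1 (Finset.mem_filter.1 hβ).1).2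

/-- The sum is antisymmetric under transpositions within a group. -/
theorem fominSum_swap (hα : valenced N d s α) (hsum : q s d = 2 * N) {u v : Fin (2 * N)}
    (huv : u ≠ v) (hg : grp d s u = grp d s v) (K : Fin (2 * N) → Fin (2 * N) → ℝ) :
    fominSum N d s α (fun i j => K (Equiv.swap u v i) (Equiv.swap u v j)) =
      -fominSum N d s α K := by
  choose! f hf hfS using fun β hβ => hα.exists_swap (β := β) hsum hg hβ
  have hff : ∀ β ∈ (LP N).filter (fun β => geqVal N d s β α), f (f β) = β := fun β hβ =>
    (isLP_of_mem_filter (hf _ (hf _ hβ))).eq_of_range_fst_eq (isLP_of_mem_filter hβ) <| by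
      ext i
      rw [hfS β hβ, hfS (f β) (hf β hβ), Equiv.swap_apply_self]
  rw [fominSum, fominSum, ← Finset.sum_neg_distrib]
  refine Finset.sum_nbij' f f hf hf hff hff fun β hβ => ?_
  exact det_comp_swap_eq_neg (isLP_of_mem_filter hβ) (isLP_of_mem_filter (hf β hβ)) huv
    (hfS β hβ) K

theorem fominSum_eq_zero_of_swap_eq (hα : valenced N d s α) (hsum : q s d = 2 * N)
    {u v : Fin (2 * N)} (huv : u ≠ v) (hg : grp d s u = grp d s v)
    {K : Fin (2 * N) → Fin (2 * N) → ℝ}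
    (hK : ∀ i j, K (Equiv.swap u v i) (Equiv.swap u v j) = K i j) :
    fominSum N d s α K = 0 := by
  have h := fominSum_swap hα hsum huv hg K
  simp only [hK] at h
  linarith

/-- Replace the row and the column of index `t` by the vector `r`. -/
noncomputable def updateCross {n : ℕ} (t : Fin n) (r : Fin n → ℝ) (K : Fin n → Fin n → ℝ)
    (i j : Fin n) : ℝ :=
  if i = t then r j else if j = t then r i else K i j

theorem isLinearMap_det_updateCross {β : (Fin N → Fin (2 * N)) × (Fin N → Fin (2 * N))}
    (hβ : isLP N β) (t : Fin (2 * N)) (K : Fin (2 * N) → Fin (2 * N) → ℝ) :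
    IsLinearMap ℝ fun r : Fin (2 * N) → ℝ =>
      Matrix.det (Matrix.of fun k l : Fin N => updateCross t r K (β.1 k) (β.2 l)) := by
  obtain ⟨k₀ | l₀, h₀⟩ := hβ.2.2.1.2 t
  · obtain rfl : β.1 k₀ = t := h₀
    have h : ∀ r : Fin (2 * N) → ℝ,
        (Matrix.of fun k l : Fin N => updateCross (β.1 k₀) r K (β.1 k) (β.2 l)) =
          (Matrix.of fun k l : Fin N => K (β.1 k) (β.2 l)).updateRow k₀ fun l => r (β.2 l) := by
      intro r
      ext k l
      by_cases hk : k = k₀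
      · subst hk; simp [updateCross]
      · simp [updateCross, hβ.strictMono.injective.eq_iff, hk,
          (hβ.fst_ne_snd _ _).symm]
    simp only [h]
    exact ⟨fun r r' => Matrix.det_updateRow_add _ _ _ _,
      fun c r => Matrix.det_updateRow_smul _ _ _ _⟩
  · obtain rfl : β.2 l₀ = t := h₀
    have h : ∀ r : Fin (2 * N) → ℝ,
        (Matrix.of fun k l : Fin N => updateCross (β.2 l₀) r K (β.1 k) (β.2 l)) =
          (Matrix.of fun k l : Fin N => K (β.1 k) (β.2 l)).updateCol l₀ fun k => r (β.1 k) := by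
      intro r
      ext k l
      by_cases hl : l = l₀
      · subst hl; simp [updateCross, hβ.fst_ne_snd]
      · simp [updateCross, hβ.snd_injective.eq_iff, hl,
          hβ.fst_ne_snd]
    simp only [h]
    exact ⟨fun r r' => Matrix.det_updateCol_add _ _ _ _,
      fun c r => Matrix.det_updateCol_smul _ _ _ _⟩

theorem isLinearMap_fominSum_updateCross (t : Fin (2 * N)) (K : Fin (2 * N) → Fin (2 * N) → ℝ) :
    IsLinearMap ℝ fun r => fominSum N d s α (updateCross t r K) where
  map_add r r' := by
    simp only [fominSum, ← Finset.sum_add_distrib]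
    exact Finset.sum_congr rfl fun β hβ =>
      (isLinearMap_det_updateCross (isLP_of_mem_filter hβ) t K).map_add r r'
  map_smul c r := by
    simp only [fominSum, Finset.smul_sum]
    exact Finset.sum_congr rfl fun β hβ =>
      (isLinearMap_det_updateCross (isLP_of_mem_filter hβ) t K).map_smul c r

/-- The sum as a linear functional of one cross of the kernel. -/
noncomputable def fominCross (N d : ℕ) (s : ℕ → ℕ)
    (α : (Fin N → Fin (2 * N)) × (Fin N → Fin (2 * N))) (t : Fin (2 * N))
    (K : Fin (2 * N) → Fin (2 * N) → ℝ) : (Fin (2 * N) → ℝ) →ₗ[ℝ] ℝ :=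
  (isLinearMap_fominSum_updateCross (d := d) (s := s) (α := α) t K).mk' _

theorem fominCross_apply (t : Fin (2 * N)) (K : Fin (2 * N) → Fin (2 * N) → ℝ)
    (r : Fin (2 * N) → ℝ) :
    fominCross N d s α t K r = fominSum N d s α (updateCross t r K) := rfl

theorem fominCross_eq_sum (t : Fin (2 * N)) (K : Fin (2 * N) → Fin (2 * N) → ℝ)
    (r : Fin (2 * N) → ℝ) :
    fominCross N d s α t K r =
      ∑ w, r w * fominCross N d s α t K (fun j => if w = j then 1 else 0) :=
  LinearMap.pi_apply_eq_sum_univ _ r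

theorem fominSum_eq_zero_of_cross (t : Fin (2 * N)) {K : Fin (2 * N) → Fin (2 * N) → ℝ}
    (h₁ : ∀ j, K t j = 0) (h₂ : ∀ j, K j t = 0) : fominSum N d s α K = 0 := by
  have h := map_zero (fominCross N d s α t K)
  rw [fominCross_apply] at h
  rw [← h]
  congr 1
  funext i j
  rw [updateCross]
  split_ifs with hi hj
  · rw [hi, h₁]; rfl
  · rw [hj, h₂]; rfl
  · rfl

theorem updateCross_self {n : ℕ} (t : Fin n) {K : Fin n → Fin n → ℝ}
    (hK : ∀ i j, K i j = K j i) : updateCross t (K t) K = K := by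
  funext i j
  rw [updateCross]
  split_ifs with hi hj
  · rw [hi]
  · rw [hj, hK]
  · rfl

theorem updateCross_symm {n : ℕ} (t : Fin n) (r : Fin n → ℝ) {K : Fin n → Fin n → ℝ}
    (hK : ∀ i j, K i j = K j i) (i j : Fin n) :
    updateCross t r K i j = updateCross t r K j i := by
  unfold updateCross
  split_ifs with hi hj hj
  · rw [hi, hj]
  · rfl
  · rfl
  · exact hK i j

/-- The sum does not see the entries of the kernel within a group: one entry. -/
theorem fominCross_single_eq_zero (hα : valenced N d s α) (hsum : q s d = 2 * N)
    {t v : Fin (2 * N)} (htv : t ≠ v) (hg : grp d s t = grp d s v)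
    {K : Fin (2 * N) → Fin (2 * N) → ℝ} (hK : ∀ i j, K i j = K j i) :
    fominCross N d s α t K (fun j => if v = j then 1 else 0) = 0 := by
  set H := updateCross t (fun j => if v = j then 1 else 0) K with hH
  have hHt : ∀ j, H t j = if v = j then 1 else 0 := fun j => by simp [hH, updateCross]
  have hHs : ∀ i j, H i j = H j i := updateCross_symm t _ hK
  set e : Fin (2 * N) → ℝ := fun j => if t = j then 1 else 0 with he
  have h1 : fominCross N d s α v H e = 0 := by
    rw [fominCross_apply]
    refine fominSum_eq_zero_of_swap_eq hα hsum htv hg fun i j => ?_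
    simp only [hH, he, updateCross, Equiv.swap_apply_def]
    grind
  have h2 : fominCross N d s α v H (H v - e) = 0 := by
    rw [fominCross_apply]
    refine fominSum_eq_zero_of_cross t (fun j => ?_) fun j => ?_ <;>
    · rcases eq_or_ne j v with rfl | hj
      · simp [updateCross, hHs _ t, hHt, he, htv]
      · simp [updateCross, hHs _ t, hHt, hj, hj.symm, htv]
  rw [fominCross_apply, ← hH, ← updateCross_self v hHs, ← fominCross_apply,
    ← sub_add_cancel (H v) e, map_add, h1, h2, add_zero]

theorem fominCross_congr (hα : valenced N d s α) (hsum : q s d = 2 * N) {t : Fin (2 * N)}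
    {K : Fin (2 * N) → Fin (2 * N) → ℝ} (hK : ∀ i j, K i j = K j i) {r r' : Fin (2 * N) → ℝ}
    (h : ∀ j : Fin (2 * N), grp d s t ≠ grp d s j → r j = r' j) (ht : r t = r' t) :
    fominCross N d s α t K r = fominCross N d s α t K r' := by
  rw [← sub_eq_zero, ← map_sub, fominCross_eq_sum]
  refine Finset.sum_eq_zero fun v _ => ?_
  by_cases hg : grp d s t = grp d s v
  · rcases eq_or_ne t v with rfl | htv
    · simp [ht]
    · rw [fominCross_single_eq_zero hα hsum htv hg hK, mul_zero]
  · simp [h v hg]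

/-- The sum does not see the entries of the kernel within a group. -/
theorem fominSum_eq_offGroup (hα : valenced N d s α) (hsum : q s d = 2 * N)
    {K : Fin (2 * N) → Fin (2 * N) → ℝ} (hK : ∀ i j, K i j = K j i) (hK₀ : ∀ i, K i i = 0) :
    fominSum N d s α K =
      fominSum N d s α fun i j => if grp d s i = grp d s j then 0 else K i j := by
  let KT : Finset (Fin (2 * N)) → Fin (2 * N) → Fin (2 * N) → ℝ := fun T i j =>
    if (i ∈ T ∨ j ∈ T) ∧ grp d s i = grp d s j then 0 else K i j
  have hKT : ∀ T i j, KT T i j = KT T j i := fun T i j => by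
    simp only [KT, or_comm (a := i ∈ T), eq_comm (a := grp d s i), hK i j]
  suffices h : ∀ T, fominSum N d s α (KT T) = fominSum N d s α K by
    rw [← h Finset.univ]
    simp [KT]
  intro T
  induction T using Finset.induction_on with
  | empty => simp [KT]
  | insert t T _ ih =>
    rw [← ih, ← updateCross_self t (hKT T), ← fominCross_apply]
    have : KT (insert t T) = updateCross t (KT (insert t T) t) (KT T) := by
      funext i j
      rw [updateCross]
      split_ifs with hi hj
      · rw [hi]
      · rw [hj, hKT]
      · simp [KT, hi, hj]
    rw [this, ← fominCross_apply]
    refine fominCross_congr hα hsum (hKT T) (fun j hj => ?_) ?_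
    · simp [KT, hj]
    · simp [KT, hK₀]

end FominSum

open Filter Topology

section Taylor

/-- The leading Taylor term of a function whose derivatives of order less than `m` vanish. -/
theorem tendsto_div_pow_of_iterated_hasDerivAt {a : ℝ} (m : ℕ) (h : ℕ → ℝ → ℝ)
    (hderiv : ∀ i, ∀ᶠ y in 𝓝 a, HasDerivAt (h i) (h (i + 1) y) y) (hzero : ∀ i, i < m → h i a = 0) :
    Tendsto (fun y => h 0 y / (y - a) ^ m) (𝓝[>] a) (𝓝 (h m a / m.factorial)) := by
  induction m generalizing h with
  | zero =>
    simpa using (hderiv 0).self_of_nhds.continuousAt.tendsto.mono_left nhdsWithin_le_nhds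
  | succ m ih =>
    refine HasDerivAt.lhopital_zero_nhdsGT (f' := h 1)
      (g' := fun y => ((m + 1 : ℕ) : ℝ) * (y - a) ^ m)
      ((hderiv 0).filter_mono nhdsWithin_le_nhds) (Eventually.of_forall fun y => ?_) ?_ ?_ ?_ ?_
    · simpa using ((hasDerivAt_id y).sub_const a).fun_pow (m + 1)
    · filter_upwards [self_mem_nhdsWithin] with y hy
      have : 0 < y - a := sub_pos.2 hy
      positivity
    · rw [← hzero 0 (Nat.succ_pos m)]
      exact (hderiv 0).self_of_nhds.continuousAt.tendsto.mono_left nhdsWithin_le_nhds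
    · have : Continuous fun y : ℝ => (y - a) ^ (m + 1) := by fun_prop
      simpa using (this.tendsto a).mono_left nhdsWithin_le_nhds
    · have := (ih (fun i => h (i + 1)) (fun i => hderiv (i + 1)) fun i hi =>
        hzero (i + 1) (by omega)).div_const ((m + 1 : ℕ) : ℝ)
      simp only [zero_add, div_div] at this
      convert this using 2
      · ring
      · rw [Nat.factorial_succ]
        push_cast
        ring

end Taylor

section DerivativeKernel

/-- The mixed partial derivative `∂_x^m ∂_y^n` of `1 / (π (x - y)²)`. -/
noncomputable def kerDeriv (m n : ℕ) (x y : ℝ) : ℝ :=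
  (-1 : ℝ) ^ m * ((m + n + 1).factorial : ℝ) / (Real.pi * (x - y) ^ (m + n + 2))

theorem kerDeriv_symm (m n : ℕ) (x y : ℝ) : kerDeriv m n x y = kerDeriv n m y x := by
  have h : y - x = -(x - y) := (neg_sub x y).symm
  rw [kerDeriv, kerDeriv, h, neg_pow (x - y), add_comm n m, pow_add (-1 : ℝ), pow_add (-1 : ℝ)]
  rcases neg_one_pow_eq_or ℝ m with hm | hm <;> rcases neg_one_pow_eq_or ℝ n with hn | hn <;>
    simp [hm, hn, neg_div, div_neg]

theorem hasDerivAt_kerDeriv (m n : ℕ) {x y : ℝ} (h : x ≠ y) :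
    HasDerivAt (fun z => kerDeriv m n z y) (kerDeriv (m + 1) n x y) x := by
  have hxy : x - y ≠ 0 := sub_ne_zero.2 h
  have h1 := (((hasDerivAt_id x).sub_const y).pow (m + n + 2)).const_mul Real.pi
  have h2 := (h1.inv (mul_ne_zero Real.pi_ne_zero (pow_ne_zero _ hxy))).const_mul
    ((-1 : ℝ) ^ m * ((m + n + 1).factorial : ℝ))
  convert! h2 using 1
  simp only [kerDeriv, id]
  rw [show m + 1 + n + 1 = (m + n + 1) + 1 by ring, Nat.factorial_succ]
  have := Real.pi_ne_zero
  push_cast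
  field_simp
  simp only [Pi.pow_apply]
  ring

/-- The off-group kernel with derivative orders `o` and positions `z`. -/
noncomputable def offKer (N d : ℕ) (s : ℕ → ℕ) (o : Fin (2 * N) → ℕ) (z : Fin (2 * N) → ℝ)
    (i j : Fin (2 * N)) : ℝ :=
  if grp d s i = grp d s j then 0 else kerDeriv (o i) (o j) (z i) (z j)

theorem offKer_symm (o : Fin (2 * N) → ℕ) (z : Fin (2 * N) → ℝ) (i j : Fin (2 * N)) :
    offKer N d s o z i j = offKer N d s o z j i := by
  rw [offKer, offKer, kerDeriv_symm]
  simp only [eq_comm]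

theorem offKer_update (o : Fin (2 * N) → ℕ) (z : Fin (2 * N) → ℝ) (t : Fin (2 * N)) (i : ℕ)
    (y : ℝ) :
    offKer N d s (Function.update o t i) (Function.update z t y) =
      updateCross t
        (fun w => if grp d s t = grp d s w then 0 else kerDeriv i (o w) y (z w))
        (offKer N d s o z) := by
  have h : ∀ v w, v = t →
      offKer N d s (Function.update o t i) (Function.update z t y) v w =
        if grp d s t = grp d s w then 0 else kerDeriv i (o w) y (z w) := by
    rintro v w rfl
    rw [offKer]
    split_ifs with hg
    · rfl
    · have hw : w ≠ v := fun e => hg (e ▸ rfl)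
      simp [Function.update_of_ne hw]
  funext v w
  rw [updateCross]
  by_cases hv : v = t
  · rw [if_pos hv, h v w hv]
  · by_cases hw : w = t
    · rw [if_neg hv, if_pos hw, offKer_symm, h w v hw]
    · simp [offKer, hv, hw]

variable {α : (Fin N → Fin (2 * N)) × (Fin N → Fin (2 * N))}

theorem hasDerivAt_fominSum_offKer (o : Fin (2 * N) → ℕ) (z : Fin (2 * N) → ℝ)
    (t : Fin (2 * N)) (i : ℕ) {y : ℝ} (hy : ∀ w : Fin (2 * N), grp d s t ≠ grp d s w → y ≠ z w) :
    HasDerivAt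
      (fun y => fominSum N d s α (offKer N d s (Function.update o t i) (Function.update z t y)))
      (fominSum N d s α
        (offKer N d s (Function.update o t (i + 1)) (Function.update z t y))) y := by
  simp only [offKer_update, ← fominCross_apply]
  rw [fominCross_eq_sum]
  have h : ∀ y, fominCross N d s α t (offKer N d s o z)
      (fun w => if grp d s t = grp d s w then 0 else kerDeriv i (o w) y (z w)) = _ :=
    fun y => fominCross_eq_sum _ _ _
  simp only [h]
  refine HasDerivAt.fun_sum fun w _ => HasDerivAt.mul_const ?_ _
  by_cases hg : grp d s t = grp d s w
  · simpa only [if_pos hg] using hasDerivAt_const y (0 : ℝ)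
  · simpa only [if_neg hg] using hasDerivAt_kerDeriv i (o w) (hy w hg)

theorem fominSum_offKer_eq_zero (hα : valenced N d s α) (hsum : q s d = 2 * N)
    {o : Fin (2 * N) → ℕ} {z : Fin (2 * N) → ℝ} {u v : Fin (2 * N)} (huv : u ≠ v)
    (hg : grp d s u = grp d s v) (ho : o u = o v) (hz : z u = z v) :
    fominSum N d s α (offKer N d s o z) = 0 := by
  have hinv : ∀ {β : Type} (f : Fin (2 * N) → β), f u = f v → ∀ i, f (Equiv.swap u v i) = f i :=
    fun f hf i => by
      rw [Equiv.swap_apply_def]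
      split_ifs with h h
      · rw [h, hf]
      · rw [h, hf]
      · rfl
  refine fominSum_eq_zero_of_swap_eq hα hsum huv hg fun i j => ?_
  simp only [offKer, grp_swap hg, hinv o ho, hinv z hz]

end DerivativeKernel

section Fusion

variable {α : (Fin N → Fin (2 * N)) × (Fin N → Fin (2 * N))}

/-- Derivative orders once the first `t` variables are consumed. -/
noncomputable def fusedOrder (N d : ℕ) (s : ℕ → ℕ) (t : ℕ) (i : Fin (2 * N)) : ℕ :=
  if (i : ℕ) < t then off d s i else 0

/-- Positions once the first `t` variables are consumed. -/
noncomputable def fusedPos (N d : ℕ) (s : ℕ → ℕ) (p : ℕ → ℝ) (t : ℕ) (x : ℕ → ℝ)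
    (i : Fin (2 * N)) : ℝ :=
  if (i : ℕ) < t then p (grp d s i) else x i

/-- The partially fused function: the result of the first `t` renormalized limits. -/
noncomputable def partialFusion (N d : ℕ) (s : ℕ → ℕ)
    (α : (Fin N → Fin (2 * N)) × (Fin N → Fin (2 * N))) (p : ℕ → ℝ) (t : ℕ) (x : ℕ → ℝ) : ℝ :=
  fominSum N d s α (offKer N d s (fusedOrder N d s t) (fusedPos N d s p t x)) /
    ∏ i ∈ Finset.range t, ((off d s i).factorial : ℝ)

theorem partialFusion_zero (hα : valenced N d s α) (hsum : q s d = 2 * N) (p x : ℕ → ℝ) :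
    partialFusion N d s α p 0 x =
      fominSum N d s α fun i j => 1 / (Real.pi * (x i - x j) ^ 2) := by
  rw [fominSum_eq_offGroup hα hsum (fun i j => by rw [← neg_sub, neg_sq]) fun i => by simp]
  rw [partialFusion, Finset.prod_range_zero, div_one]
  congr 1
  funext i j
  simp [offKer, kerDeriv, fusedOrder, fusedPos]

theorem tendsto_partialFusion (hα : valenced N d s α) (hsum : q s d = 2 * N) {p : ℕ → ℝ}
    (hp : chamber d p) {t : ℕ} (ht : t < 2 * N) {x : ℕ → ℝ}
    (hx : ∀ i, t < i → i < 2 * N → p (grp d s t) < x i) :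
    Tendsto (fun y : ℝ => |y - p (grp d s t)| ^ (-(off d s t : ℤ)) *
        partialFusion N d s α p t (Function.update x t y))
      (𝓝[>] p (grp d s t)) (𝓝 (partialFusion N d s α p (t + 1) x)) := by
  set a := p (grp d s t)
  set m := off d s t
  set t' : Fin (2 * N) := ⟨t, ht⟩
  set o := fusedOrder N d s t
  set z := fusedPos N d s p t x
  obtain ⟨hgd, hq1, hq2⟩ := grp_spec (hsum.symm ▸ ht : t < q s d)
  have hpinj : ∀ w : Fin (2 * N), grp d s t ≠ grp d s w → a ≠ p (grp d s w) := fun w hw => by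
    obtain ⟨hwd, -, -⟩ := grp_spec (hsum.symm ▸ w.2 : (w : ℕ) < q s d)
    rcases hw.lt_or_gt with h | h
    · exact (hp _ _ h hwd).ne
    · exact (hp _ _ h hgd).ne'
  have hz : ∀ w : Fin (2 * N), grp d s t ≠ grp d s w → a ≠ z w := fun w hw => by
    simp only [z, fusedPos]
    split_ifs with hwt
    · exact hpinj w hw
    · exact (hx w (lt_of_le_of_ne (not_lt.1 hwt) fun e => hw (e ▸ rfl)) w.2).ne
  have hev : ∀ᶠ y in 𝓝 a, ∀ w : Fin (2 * N), grp d s t ≠ grp d s w → y ≠ z w := by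
    rw [eventually_all]
    intro w
    by_cases hw : grp d s t = grp d s w
    · exact Eventually.of_forall fun y h => (h hw).elim
    · filter_upwards [eventually_ne_nhds (hz w hw)] with y hy _ using hy
  have hlim := tendsto_div_pow_of_iterated_hasDerivAt (a := a) m
    (fun i y => fominSum N d s α
      (offKer N d s (Function.update o t' i) (Function.update z t' y)))
    (fun i => hev.mono fun y hy => hasDerivAt_fominSum_offKer o z t' i hy)
    fun i hi => by
      have hm : m = t - q s (grp d s t) := rfl
      have hu : q s (grp d s t) + i < t := by omega
      have hg : grp d s (q s (grp d s t) + i) = grp d s t :=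
        grp_eq hgd (by omega) (by omega)
      have hne : (⟨q s (grp d s t) + i, hu.trans ht⟩ : Fin (2 * N)) ≠ t' := fun e =>
        hu.ne (congrArg Fin.val e)
      refine fominSum_offKer_eq_zero hα hsum hne hg ?_ ?_
      · rw [Function.update_self, Function.update_of_ne hne]
        simp only [o, fusedOrder, if_pos hu]
        rw [off, hg, Nat.add_sub_cancel_left]
      · rw [Function.update_self, Function.update_of_ne hne]
        simp only [z, fusedPos, if_pos hu, hg, a]
  have ho_zero : Function.update o t' 0 = o := by
    rw [Function.update_eq_self_iff]
    simp [o, fusedOrder, t']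
  have ho_succ : Function.update o t' m = fusedOrder N d s (t + 1) := by
    funext i
    rcases eq_or_ne i t' with rfl | hi
    · simp [fusedOrder, t', m]
    · have : (i : ℕ) ≠ t := fun e => hi (Fin.ext e)
      simp only [Function.update_of_ne hi, o, fusedOrder]
      exact if_congr (by omega) rfl rfl
  have hz_update : ∀ y, fusedPos N d s p t (Function.update x t y) = Function.update z t' y := by
    intro y
    funext i
    rcases eq_or_ne i t' with rfl | hi
    · simp [fusedPos, t']
    · have : (i : ℕ) ≠ t := fun e => hi (Fin.ext e)
      simp [z, fusedPos, Function.update_of_ne hi, Function.update_of_ne this]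
  have hz_succ : Function.update z t' a = fusedPos N d s p (t + 1) x := by
    funext i
    rcases eq_or_ne i t' with rfl | hi
    · simp [fusedPos, t', a]
    · have : (i : ℕ) ≠ t := fun e => hi (Fin.ext e)
      simp only [Function.update_of_ne hi, z, fusedPos]
      exact if_congr (by omega) rfl rfl
  have hlim' := hlim.div_const (∏ i ∈ Finset.range t, ((off d s i).factorial : ℝ))
  simp only [ho_zero, ho_succ, hz_succ, div_div] at hlim'
  rw [partialFusion, Finset.prod_range_succ, mul_comm (Finset.prod _ _)]
  refine hlim'.congr' ?_
  filter_upwards [self_mem_nhdsWithin] with y hy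
  rw [abs_of_pos (sub_pos.2 hy), zpow_neg, zpow_natCast, partialFusion, hz_update,
    div_mul_eq_div_div, inv_mul_eq_div, div_right_comm]

theorem ker_eq_kerDeriv (p : ℕ → ℝ) {u v : ℕ} (h : grp d s u ≠ grp d s v) :
    ker d s p u v = kerDeriv (off d s u) (off d s v) (p (grp d s u)) (p (grp d s v)) := by
  rw [ker, if_neg h]
  split_ifs with hlt
  · rw [kerDeriv_symm, kerDeriv, add_comm (off d s v)]
  · dsimp only
    rw [kerDeriv, add_comm (off d s v)]

theorem U_eq_fominSum (p x : ℕ → ℝ) :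
    U N d s α p = fominSum N d s α
      (offKer N d s (fusedOrder N d s (2 * N)) (fusedPos N d s p (2 * N) x)) := by
  have : ∀ i j : Fin (2 * N), offKer N d s (fusedOrder N d s (2 * N))
      (fusedPos N d s p (2 * N) x) i j = ker d s p i j := fun i j => by
    rw [offKer]
    split_ifs with h
    · rw [ker, if_pos h]
    · simp [ker_eq_kerDeriv p h, fusedOrder, fusedPos]
  simp only [U, Δ, fominSum, this]

end Fusion

end UST

/-- The fusion property of Theorem D.2 of the paper (the analogue of property (FUS) of
Theorem 1.3 for the explicit basis functions): the fused function `U_α(p_1, …, p_d)` is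
recovered from its totally unfused counterpart
`F(x) = Σ_{β ≥_ς α} det(1/(π (x_{a_k} − x_{b_ℓ})²))` by iterated renormalized boundary-point
collisions, one variable at a time.  The iteration is encoded by a sequence of functions
`G t` (`G 0 = F`): at step `t` the variable `x_t` tends (within the chamber, i.e. from the
right) to the target `p_{grp t}` of its group, renormalized by `|x_t − p_{grp t}|^{−off t}`
(`off t` is the 0-based offset, so the renormalizing powers within a group are
`0, 1, …, s_j − 1`); every such limit exists (for configurations whose consumed coordinates
sit at their targets and whose remaining coordinates are ordered, lie above the current
target, and avoid all targets), and after all `2N` steps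
`U_α(p) = (∏_j 0!·1!⋯(s_j−1)!) · (the resulting iterated limit)`. -/
theorem stmt19 (N d : ℕ) (hN : 0 < N) (hd : 0 < d) (s : ℕ → ℕ)
    (hs : ∀ i, i < d → 0 < s i) (hsum : UST.q s d = 2 * N)
    (α : (Fin N → Fin (2 * N)) × (Fin N → Fin (2 * N)))
    (hα : UST.valenced N d s α)
    (p : ℕ → ℝ) (hp : UST.chamber d p) :
    ∃ G : ℕ → (ℕ → ℝ) → ℝ,
      (G 0 = fun x =>
        ∑ β ∈ (UST.LP N).filter (fun β => UST.geqVal N d s β α),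
          Matrix.det (Matrix.of fun k ℓ : Fin N =>
            1 / (Real.pi * (x ((β.1 k : ℕ)) - x ((β.2 ℓ : ℕ))) ^ 2))) ∧
      (∀ t, t < 2 * N → ∀ x : ℕ → ℝ,
        (∀ i, i < t → x i = p (UST.grp d s i)) →
        (∀ i i', t < i → i < i' → i' < 2 * N → x i < x i') →
        (∀ i, t < i → i < 2 * N → p (UST.grp d s t) < x i) →
        (∀ i j', t < i → i < 2 * N → j' < d → x i ≠ p j') →
        Filter.Tendsto
          (fun y : ℝ =>
            |y - p (UST.grp d s t)| ^ (-(UST.off d s t : ℤ)) *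
              G t (Function.update x t y))
          (nhdsWithin (p (UST.grp d s t)) (Set.Ioi (p (UST.grp d s t))))
          (nhds (G (t + 1) x))) ∧
      UST.U N d s α p =
        (∏ j ∈ Finset.range d, ∏ r ∈ Finset.range (s j), (r.factorial : ℝ)) *
          G (2 * N) (fun i => p (UST.grp d s i)) := by
  refine ⟨UST.partialFusion N d s α p, funext (UST.partialFusion_zero hα hsum p),
    fun t ht x _ _ hx _ => UST.tendsto_partialFusion hα hsum hp ht hx, ?_⟩
  rw [UST.partialFusion, ← UST.U_eq_fominSum, ← hsum, UST.prod_factorial_off,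
    mul_div_cancel₀]
  positivity
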